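/- Let J ≥ 1, let a ∈ ℝ^J, fix j ∈ {1, …, J}, and define h : ℝ → ℝ by h(t) = exp(t + a_j) / (1 + Σ_{b=1}^{J} exp(t + a_b)). Let s̃_j = exp(a_j) / Σ_{b=1}^{J} exp(a_b). Then h is continuous and strictly increasing on ℝ, h(t) → 0 as t → −∞, h(t) → s̃_j as t → +∞, and the range of h is exactly the open interval (0, s̃_j). -/

import Mathlib

open Real Filter

/-- Dividing numerator and denominator of the logit share by `exp t`. -/
lemma logit_share_eq {ι : Type*} [Fintype ι] (a : ι → ℝ) (j : ι) (t : ℝ) :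
    Real.exp (t + a j) / (1 + ∑ b, Real.exp (t + a b)) =
      Real.exp (a j) / (Real.exp (-t) + ∑ b, Real.exp (a b)) := by
  have hden : 1 + ∑ b, Real.exp (t + a b) =
      Real.exp t * (Real.exp (-t) + ∑ b, Real.exp (a b)) := by
    rw [mul_add, ← Real.exp_add, add_neg_cancel, Real.exp_zero, Finset.mul_sum]
    simp only [Real.exp_add]
  rw [hden, Real.exp_add, mul_div_mul_left _ _ (Real.exp_ne_zero t)]

/-- With `h t = exp (t + a j) / (1 + ∑ b, exp (t + a b))` and
`s̃ j = exp (a j) / ∑ b, exp (a b)`, the function `h` is continuous and strictly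
increasing, tends to `0` at `−∞` and to `s̃ j` at `+∞`, and its range is exactly
the open interval `(0, s̃ j)`. -/
theorem logit_intercept_share_range
    (J : ℕ) (hJ : 1 ≤ J) (a : Fin J → ℝ) (j : Fin J) :
    Continuous (fun t : ℝ =>
      Real.exp (t + a j) / (1 + ∑ b : Fin J, Real.exp (t + a b))) ∧
    StrictMono (fun t : ℝ =>
      Real.exp (t + a j) / (1 + ∑ b : Fin J, Real.exp (t + a b))) ∧
    Tendsto (fun t : ℝ =>
      Real.exp (t + a j) / (1 + ∑ b : Fin J, Real.exp (t + a b))) atBot (nhds 0) ∧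
    Tendsto (fun t : ℝ =>
      Real.exp (t + a j) / (1 + ∑ b : Fin J, Real.exp (t + a b))) atTop
      (nhds (Real.exp (a j) / ∑ b : Fin J, Real.exp (a b))) ∧
    Set.range (fun t : ℝ =>
      Real.exp (t + a j) / (1 + ∑ b : Fin J, Real.exp (t + a b))) =
      Set.Ioo 0 (Real.exp (a j) / ∑ b : Fin J, Real.exp (a b)) := by
  simp only [logit_share_eq]
  have hc : 0 < Real.exp (a j) := Real.exp_pos _
  have hS : 0 < ∑ b, Real.exp (a b) :=
    Finset.sum_pos (fun b _ => Real.exp_pos _) ⟨j, Finset.mem_univ j⟩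
  generalize Real.exp (a j) = c at *
  generalize ∑ b, Real.exp (a b) = S at *
  have hpos (t : ℝ) : 0 < Real.exp (-t) + S := by positivity
  have hcont : Continuous fun t : ℝ => c / (Real.exp (-t) + S) :=
    Continuous.div (by fun_prop) (by fun_prop) fun t => (hpos t).ne'
  have hbot : Tendsto (fun t : ℝ => c / (Real.exp (-t) + S)) atBot (nhds 0) :=
    (tendsto_atTop_add_const_right _ S
      (Real.tendsto_exp_atTop.comp tendsto_neg_atBot_atTop)).const_div_atTop c
  have htop : Tendsto (fun t : ℝ => c / (Real.exp (-t) + S)) atTop (nhds (c / S)) := by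
    have hden : Tendsto (fun t : ℝ => Real.exp (-t) + S) atTop (nhds S) := by
      simpa using Real.tendsto_exp_neg_atTop_nhds_zero.add_const S
    exact tendsto_const_nhds.div hden hS.ne'
  refine ⟨hcont, fun x y hxy => ?_, hbot, htop, Set.Subset.antisymm ?_ fun y hy => ?_⟩
  · exact div_lt_div_of_pos_left hc (hpos y) (by gcongr)
  · rintro _ ⟨t, rfl⟩
    exact ⟨div_pos hc (hpos t),
      div_lt_div_of_pos_left hc hS (lt_add_of_pos_left S (Real.exp_pos _))⟩
  · obtain ⟨l, hl⟩ := (hbot.eventually_lt_const hy.1).exists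
    obtain ⟨u, hu⟩ := (htop.eventually_const_lt hy.2).exists
    exact mem_range_of_exists_le_of_exists_ge hcont ⟨l, hl.le⟩ ⟨u, hu.le⟩
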